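/- arXiv:2310.05509 — 2 statements merged into one kernel-verified Lean document; each statement's English description precedes it below -/
import Mathlib

section
/- Assume a3 ≠ 0 and a2^2 - 4*a1*a3 > 0 (so X has exactly six critical points on the equator, which are cusps), and assume there are no homoclinic or heteroclinic connections among the equator critical points, i.e. there is no non-constant solution f : R -> R^3 of (S) taking values in the unit sphere such that f(t) converges as t -> +infinity to a point p on the equator with X(p) = 0 and f(t) converges as t -> -infinity to a point q on the equator with X(q) = 0. Then the system (S) has a periodic solution on the unit sphere symmetric with respect to the origin that crosses the equator at regular points: there exist T > 0 and a solution f : R -> R^3 of (S) with (f1(t))^2 + (f2(t))^2 + (f3(t))^2 = 1 for all t, f(t+T) = -f(t) for all t, and there exists t0 with f3(t0) = 0 and X(f(t0)) ≠ 0. -/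
/-- The compactified vector field on the Poincaré sphere; a point of `ℝ × ℝ × ℝ`
is written `z = (z₁, z₂, z₃)` with `z.1 = z₁`, `z.2.1 = z₂`, `z.2.2 = z₃`. -/
noncomputable def Xfield (b1 b2 a1 a2 a3 : ℝ) (z : ℝ × ℝ × ℝ) : ℝ × ℝ × ℝ :=
  (z.2.2 * (-z.2.1 * z.2.2 + b1 * z.1^2 * z.2.2^2 + b2 * z.1 * z.2.1 * z.2.2^2
      + a1 * z.1^4 + a2 * z.1^3 * z.2.1 + a3 * z.1^2 * z.2.1^2),
   z.2.2 * (z.1 * z.2.2 + b1 * z.1 * z.2.1 * z.2.2^2 + b2 * z.2.1^2 * z.2.2^2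
      + a1 * z.1^3 * z.2.1 + a2 * z.1^2 * z.2.1^2 + a3 * z.1 * z.2.1^3),
   (z.2.2^2 - 1) * (b1 * z.1 * z.2.2^2 + b2 * z.2.1 * z.2.2^2
      + a1 * z.1^3 + a2 * z.1^2 * z.2.1 + a3 * z.1 * z.2.1^2))

/-- `f : ℝ → ℝ × ℝ × ℝ` is a (global) solution of the system (S). -/
def IsSolutionS (b1 b2 a1 a2 a3 : ℝ) (f : ℝ → ℝ × ℝ × ℝ) : Prop :=
  ∀ t : ℝ, HasDerivAt f (Xfield b1 b2 a1 a2 a3 (f t)) t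

open Set Filter Topology
open scoped NNReal

section GlobalFlow

variable {E : Type*} [NormedAddCommGroup E] [NormedSpace ℝ E]

/-- Solutions of an autonomous equation with Lipschitz right-hand side are determined by one
value. -/
theorem solution_unique {V : E → E} {K : ℝ≥0} (hV : LipschitzWith K V) {y z : ℝ → E}
    (hy : ∀ t, HasDerivAt y (V (y t)) t) (hz : ∀ t, HasDerivAt z (V (z t)) t) {t₀ : ℝ}
    (h : y t₀ = z t₀) : y = z :=
  ODE_solution_unique_univ (v := fun _ => V) (s := fun _ => univ) (K := K)
    (fun _ => hV.lipschitzOnWith) (fun t => ⟨hy t, mem_univ _⟩) (fun t => ⟨hz t, mem_univ _⟩) h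

/-- A bounded Lipschitz vector field on a Banach space is complete. -/
theorem exists_global_solution [CompleteSpace E] {V : E → E} {K C : ℝ≥0}
    (hV : LipschitzWith K V) (hC : ∀ x, ‖V x‖ ≤ C) (x : E) :
    ∃ y : ℝ → E, y 0 = x ∧ ∀ t, HasDerivAt y (V (y t)) t := by
  have key : ∀ n : ℕ, ∃ y : ℝ → E, y 0 = x ∧
      ∀ t ∈ Ioo (-((n : ℝ) + 1)) ((n : ℝ) + 1), HasDerivAt y (V (y t)) t := by
    intro n
    have h0 : (0 : ℝ) ∈ Icc (-((n : ℝ) + 1)) ((n : ℝ) + 1) := by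
      constructor <;> linarith [n.cast_nonneg (α := ℝ)]
    have hPL : IsPicardLindelof (fun _ => V) (⟨0, h0⟩ : Icc (-((n : ℝ) + 1)) ((n : ℝ) + 1))
        x (C * (n + 1)) 0 C K := by
      refine ⟨fun _ _ => hV.lipschitzOnWith, fun _ _ => continuousOn_const,
        fun _ _ z _ => hC z, ?_⟩
      simp
    obtain ⟨y, hy0, hy⟩ := hPL.exists_eq_forall_mem_Icc_hasDerivWithinAt₀
    exact ⟨y, hy0, fun t ht =>
      (hy t (Ioo_subset_Icc_self ht)).hasDerivAt (Icc_mem_nhds ht.1 ht.2)⟩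
  choose y hy0 hy using key
  have huniq : ∀ m n : ℕ, m ≤ n →
      EqOn (y m) (y n) (Ioo (-((m : ℝ) + 1)) ((m : ℝ) + 1)) := by
    intro m n hmn
    have hmn' : (m : ℝ) ≤ n := by exact_mod_cast hmn
    have hm := m.cast_nonneg (α := ℝ)
    refine ODE_solution_unique_of_mem_Ioo (v := fun _ => V) (s := fun _ => univ) (K := K)
      (t₀ := 0) (fun _ _ => hV.lipschitzOnWith) ⟨by linarith, by linarith⟩
      (fun t ht => ⟨hy m t ht, mem_univ _⟩)
      (fun t ht => ⟨hy n t ⟨by linarith [ht.1], by linarith [ht.2]⟩, mem_univ _⟩) ?_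
    rw [hy0, hy0]
  refine ⟨fun t => y ⌊|t|⌋₊ t, hy0 _, fun t => ?_⟩
  have hfl : ∀ s : ℝ, s ∈ Ioo (-((⌊|s|⌋₊ : ℝ) + 1)) ((⌊|s|⌋₊ : ℝ) + 1) := fun s =>
    abs_lt.1 (Nat.lt_floor_add_one _)
  have hev : (fun s => y ⌊|s|⌋₊ s) =ᶠ[𝓝 t] y (⌊|t|⌋₊ + 1) := by
    have : ∀ᶠ s in 𝓝 t, |s| < (⌊|t|⌋₊ : ℝ) + 1 :=
      continuous_abs.continuousAt.eventually_lt continuousAt_const (Nat.lt_floor_add_one _)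
    filter_upwards [this] with s hs
    refine huniq _ _ ?_ (hfl s)
    have : ⌊|s|⌋₊ < ⌊|t|⌋₊ + 1 := (Nat.floor_lt (abs_nonneg _)).2 (by exact_mod_cast hs)
    exact this.le
  have ht := hfl t
  have := hy (⌊|t|⌋₊ + 1) t (by push_cast; constructor <;> linarith [ht.1, ht.2])
  rw [← hev.self_of_nhds] at this
  exact this.congr_of_eventuallyEq hev

end GlobalFlow

section BddLip

/-- Bounded Lipschitz real-valued functions. -/
def BddLip {α : Type*} [PseudoMetricSpace α] (f : α → ℝ) : Prop :=
  (∃ C : ℝ, ∀ x, |f x| ≤ C) ∧ ∃ K : ℝ≥0, LipschitzWith K f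

variable {α β : Type*} [PseudoMetricSpace α] [PseudoMetricSpace β] {f g : α → ℝ}

theorem BddLip.const (c : ℝ) : BddLip (fun _ : α => c) :=
  ⟨⟨|c|, fun _ => le_rfl⟩, 0, LipschitzWith.const c⟩

theorem BddLip.add (hf : BddLip f) (hg : BddLip g) : BddLip (fun x => f x + g x) := by
  obtain ⟨⟨C, hC⟩, K, hK⟩ := hf
  obtain ⟨⟨D, hD⟩, L, hL⟩ := hg
  exact ⟨⟨C + D, fun x => (abs_add_le _ _).trans (add_le_add (hC x) (hD x))⟩, K + L, hK.add hL⟩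

theorem BddLip.neg (hf : BddLip f) : BddLip (fun x => -f x) := by
  obtain ⟨⟨C, hC⟩, K, hK⟩ := hf
  exact ⟨⟨C, fun x => by simpa using hC x⟩, K, hK.neg⟩

theorem BddLip.mul (hf : BddLip f) (hg : BddLip g) : BddLip (fun x => f x * g x) := by
  obtain ⟨⟨C, hC⟩, K, hK⟩ := hf
  obtain ⟨⟨D, hD⟩, L, hL⟩ := hg
  refine ⟨⟨C * D, fun x => ?_⟩, K * D.toNNReal + C.toNNReal * L, ?_⟩
  · rw [abs_mul]
    exact mul_le_mul (hC x) (hD x) (abs_nonneg _) ((abs_nonneg _).trans (hC x))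
  · refine LipschitzWith.of_dist_le_mul fun x y => ?_
    have hC0 := (abs_nonneg _).trans (hC x)
    have hD0 := (abs_nonneg _).trans (hD x)
    have h1 := hK.dist_le_mul x y
    have h2 := hL.dist_le_mul x y
    rw [Real.dist_eq] at h1 h2 ⊢
    push_cast
    rw [Real.coe_toNNReal _ hC0, Real.coe_toNNReal _ hD0]
    calc |f x * g x - f y * g y| = |(f x - f y) * g x + f y * (g x - g y)| := by ring_nf
      _ ≤ |f x - f y| * |g x| + |f y| * |g x - g y| := by
        rw [← abs_mul, ← abs_mul]; exact abs_add_le _ _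
      _ ≤ (K * dist x y) * D + C * (L * dist x y) := by
        gcongr
        · exact hD x
        · exact hC y
      _ = _ := by ring

theorem BddLip.comp {h : β → α} {L : ℝ≥0} (hf : BddLip f) (hh : LipschitzWith L h) :
    BddLip (fun x => f (h x)) := by
  obtain ⟨⟨C, hC⟩, K, hK⟩ := hf
  exact ⟨⟨C, fun x => hC _⟩, K * L, hK.comp hh⟩

theorem BddLip.fst {f : ℝ → ℝ} (hf : BddLip f) : BddLip (fun y : ℝ × ℝ => f y.1) :=
  hf.comp LipschitzWith.prod_fst

theorem BddLip.snd {f : ℝ → ℝ} (hf : BddLip f) : BddLip (fun y : ℝ × ℝ => f y.2) :=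
  hf.comp LipschitzWith.prod_snd

theorem bddLip_cos : BddLip Real.cos :=
  ⟨⟨1, Real.abs_cos_le_one⟩, 1, Real.lipschitzWith_cos⟩

theorem bddLip_sin : BddLip Real.sin :=
  ⟨⟨1, Real.abs_sin_le_one⟩, 1, Real.lipschitzWith_sin⟩

theorem bddLip_inv_sq_add {ε : ℝ} (hε : 0 < ε) : BddLip (fun u : ℝ => (u ^ 2 + ε)⁻¹) := by
  have hpos : ∀ u : ℝ, 0 < u ^ 2 + ε := fun u => by positivity
  refine ⟨⟨ε⁻¹, fun u => ?_⟩, (ε⁻¹ * (1 + ε⁻¹)).toNNReal, ?_⟩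
  · rw [abs_of_pos (inv_pos.2 (hpos u))]
    exact inv_anti₀ hε (by nlinarith [sq_nonneg u])
  · refine LipschitzWith.of_dist_le_mul fun u v => ?_
    rw [Real.dist_eq, Real.dist_eq, Real.coe_toNNReal _ (by positivity)]
    have hab : ∀ w : ℝ, |w| * (w ^ 2 + ε)⁻¹ ≤ (1 + ε⁻¹) / 2 := by
      intro w
      rw [← div_eq_mul_inv, div_le_iff₀ (hpos w)]
      have h1 : |w| ≤ (w ^ 2 + 1) / 2 := by nlinarith [sq_nonneg (|w| - 1), sq_abs w]
      have h2 : (1 + ε⁻¹) / 2 * (w ^ 2 + ε) = (w ^ 2 + 1) / 2 + (ε + ε⁻¹ * w ^ 2) / 2 := by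
        field_simp; ring
      have : 0 ≤ ε⁻¹ * w ^ 2 := by positivity
      linarith
    have e : (u ^ 2 + ε)⁻¹ - (v ^ 2 + ε)⁻¹
        = (v - u) * ((u + v) * ((u ^ 2 + ε)⁻¹ * (v ^ 2 + ε)⁻¹)) := by
      have := (hpos u).ne'
      have := (hpos v).ne'
      field_simp; ring
    rw [e, abs_mul, abs_sub_comm v u, mul_comm]
    gcongr
    rw [abs_mul, abs_of_pos (mul_pos (inv_pos.2 (hpos u)) (inv_pos.2 (hpos v)))]
    have hu := inv_pos.2 (hpos u)
    have hv := inv_pos.2 (hpos v)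
    calc |u + v| * ((u ^ 2 + ε)⁻¹ * (v ^ 2 + ε)⁻¹)
        ≤ (|u| + |v|) * ((u ^ 2 + ε)⁻¹ * (v ^ 2 + ε)⁻¹) := by gcongr; exact abs_add_le _ _
      _ = (|u| * (u ^ 2 + ε)⁻¹) * (v ^ 2 + ε)⁻¹ + (|v| * (v ^ 2 + ε)⁻¹) * (u ^ 2 + ε)⁻¹ := by
        ring
      _ ≤ ((1 + ε⁻¹) / 2) * ε⁻¹ + ((1 + ε⁻¹) / 2) * ε⁻¹ := by
        gcongr
        · exact hab u
        · nlinarith [sq_nonneg v]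
        · exact hab v
        · nlinarith [sq_nonneg u]
      _ = _ := by ring

/-- A planar vector field with bounded Lipschitz components is Lipschitz and complete. -/
theorem BddLip.planar_flow {F G : ℝ × ℝ → ℝ} (hF : BddLip F) (hG : BddLip G) :
    (∃ K : ℝ≥0, LipschitzWith K fun y => (F y, G y)) ∧
      ∀ x : ℝ × ℝ, ∃ y : ℝ → ℝ × ℝ, y 0 = x ∧ ∀ t, HasDerivAt y (F (y t), G (y t)) t := by
  obtain ⟨⟨C, hC⟩, K, hK⟩ := hF
  obtain ⟨⟨D, hD⟩, L, hL⟩ := hG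
  refine ⟨⟨max K L, hK.prodMk hL⟩, fun x => ?_⟩
  refine exists_global_solution (hK.prodMk hL) (C := (max C D).toNNReal) (fun y => ?_) x
  rw [Real.coe_toNNReal _ (((abs_nonneg _).trans (hC y)).trans (le_max_left _ _))]
  exact max_le_max (hC y) (hD y)

end BddLip

section Regularized

theorem HasDerivAt.fst_of_prod {y : ℝ → ℝ × ℝ} {y' : ℝ × ℝ} {t : ℝ} (h : HasDerivAt y y' t) :
    HasDerivAt (fun s => (y s).1) y'.1 t := by
  simpa using h.hasFDerivAt.fst.hasDerivAt

theorem HasDerivAt.snd_of_prod {y : ℝ → ℝ × ℝ} {y' : ℝ × ℝ} {t : ℝ} (h : HasDerivAt y y' t) :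
    HasDerivAt (fun s => (y s).2) y'.2 t := by
  simpa using h.hasFDerivAt.snd.hasDerivAt

theorem abs_le_add_mul_of_abs_deriv_lt {u u' : ℝ → ℝ} {C R P : ℝ} (hC : 0 ≤ C)
    (hu : ∀ t, HasDerivAt u (u' t) t) (hu' : ∀ t, 1 ≤ |u t| → |u' t| < C) (hR : 1 ≤ R)
    (h0 : |u 0| ≤ R) {t : ℝ} (ht : t ∈ Icc 0 P) : |u t| ≤ R + C * t := by
  refine image_norm_le_of_norm_deriv_right_lt_deriv_boundary (f := u) (f' := u')
    (B := fun s => R + C * s) (B' := fun _ => C) (a := 0) (b := P)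
    (fun s _ => (hu s).continuousAt.continuousWithinAt) (fun s _ => (hu s).hasDerivWithinAt)
    (by simpa using h0) (fun s => by simpa using ((hasDerivAt_id s).const_mul C).const_add R)
    (fun s hs h => hu' s ?_) ht
  rw [← Real.norm_eq_abs, h]
  have := mul_nonneg hC hs.1
  linarith

theorem sub_mul_le_of_abs_deriv_lt {u u' : ℝ → ℝ} {C P : ℝ} (hC : 0 ≤ C) (hP : 0 ≤ P)
    (hu : ∀ t, HasDerivAt u (u' t) t) (hu' : ∀ t, 1 ≤ |u t| → |u' t| < C)
    (h0 : 1 + C * P ≤ u 0) : u 0 - C * P ≤ u P := by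
  have := image_le_of_deriv_right_lt_deriv_boundary (f := fun s => -u s) (f' := fun s => -u' s)
    (B := fun s => -u 0 + C * s) (B' := fun _ => C) (a := 0) (b := P)
    (fun s _ => (hu s).neg.continuousAt.continuousWithinAt)
    (fun s _ => (hu s).neg.hasDerivWithinAt) (by simp)
    (fun s => by simpa using ((hasDerivAt_id s).const_mul C).const_add (-u 0))
    (fun s hs h => ?_) (right_mem_Icc.2 hP)
  · linarith
  · refine (neg_le_abs _).trans_lt (hu' s ?_)
    have := mul_le_mul_of_nonneg_left hs.2.le hC
    exact le_trans (by linarith) (le_abs_self (u s))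

/-- For odd data, the regularized equation `(u² + ε) u' = -(A + B u²)` has an antiperiodic
solution, bounded independently of `ε`. -/
theorem exists_antiperiodic_regularized {A B : ℝ → ℝ} (hA : BddLip A) (hB : BddLip B) {P : ℝ}
    (hP : 0 < P) (hAP : ∀ θ, A (θ + P) = -A θ) (hBP : ∀ θ, B (θ + P) = -B θ) :
    ∃ M : ℝ, ∀ ε > (0 : ℝ), ∃ u : ℝ → ℝ,
      (∀ θ, HasDerivAt u (-(A θ + B θ * u θ ^ 2) / (u θ ^ 2 + ε)) θ) ∧
      (∀ θ, u (θ + P) = -u θ) ∧ ∀ θ, |u θ| ≤ M := by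
  obtain ⟨CA, hCA⟩ := hA.1
  obtain ⟨CB, hCB⟩ := hB.1
  have hCA0 := (abs_nonneg _).trans (hCA 0)
  have hCB0 := (abs_nonneg _).trans (hCB 0)
  set C := CA + CB + 1 with hCdef
  have hC : 0 ≤ C := by positivity
  set R := 1 + C * P with hR
  have hR1 : 1 ≤ R := by have := mul_nonneg hC hP.le; linarith
  refine ⟨R + C * P, fun ε hε => ?_⟩
  set G : ℝ × ℝ → ℝ := fun y =>
    -(B y.1 * (1 + -(ε * (y.2 ^ 2 + ε)⁻¹)) + A y.1 * (y.2 ^ 2 + ε)⁻¹) with hGdef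
  have hG : BddLip G := (((hB.fst).mul ((BddLip.const 1).add
    (((BddLip.const ε).mul (bddLip_inv_sq_add hε).snd).neg))).add
      (hA.fst.mul (bddLip_inv_sq_add hε).snd)).neg
  have hG_eq : ∀ θ u, G (θ, u) = -(A θ + B θ * u ^ 2) / (u ^ 2 + ε) := by
    intro θ u
    have : u ^ 2 + ε ≠ 0 := by positivity
    simp only [hGdef]
    field_simp
    ring
  obtain ⟨⟨K, hK⟩, hflow⟩ := BddLip.planar_flow (BddLip.const 1) hG
  choose Y hY0 hY using hflow
  have hfst : ∀ x t, (Y (0, x) t).1 = t := by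
    intro x t
    have hd : ∀ s, HasDerivAt (fun s => (Y (0, x) s).1 - s) 0 s := fun s =>
      ((hY (0, x) s).fst_of_prod.sub (hasDerivAt_id s)).congr_deriv (by simp)
    have := is_const_of_deriv_eq_zero (fun s => (hd s).differentiableAt)
      (fun s => (hd s).deriv) t 0
    simp only [hY0] at this
    linarith
  have hpt : ∀ x t, Y (0, x) t = (t, (Y (0, x) t).2) := fun x t => Prod.ext (hfst x t) rfl
  have hu : ∀ x t, HasDerivAt (fun s => (Y (0, x) s).2)
      (-(A t + B t * (Y (0, x) t).2 ^ 2) / ((Y (0, x) t).2 ^ 2 + ε)) t := by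
    intro x t
    have := (hY (0, x) t).snd_of_prod
    rwa [hpt, hG_eq] at this
  have hbd : ∀ θ u : ℝ, 1 ≤ |u| → |-(A θ + B θ * u ^ 2) / (u ^ 2 + ε)| < C := by
    intro θ u h1
    have h2 : 1 ≤ u ^ 2 := (one_le_sq_iff_one_le_abs u).2 h1
    have hpos : 0 < u ^ 2 + ε := by positivity
    rw [abs_div, abs_neg, abs_of_pos hpos, div_lt_iff₀ hpos]
    calc |A θ + B θ * u ^ 2| ≤ |A θ| + |B θ| * u ^ 2 := by
          refine (abs_add_le _ _).trans_eq ?_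
          rw [abs_mul, abs_of_nonneg (sq_nonneg u)]
      _ ≤ CA * u ^ 2 + CB * u ^ 2 := by
          gcongr
          · nlinarith [hCA θ]
          · exact hCB θ
      _ < C * (u ^ 2 + ε) := by nlinarith [mul_nonneg hC hε.le]
  have hcont : Continuous fun x : ℝ => (Y (0, x) P).2 + x := by
    refine Continuous.add ?_ continuous_id
    refine (LipschitzWith.of_dist_le_mul (K := (Real.exp (K * P)).toNNReal)
      fun x z => ?_).continuous
    rw [Real.coe_toNNReal _ (Real.exp_pos _).le, mul_comm]
    have := dist_le_of_trajectories_ODE (v := fun _ => fun y => (1, G y)) (K := K)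
      (f := Y (0, x)) (g := Y (0, z)) (a := 0) (b := P) (δ := dist x z) (fun _ => hK)
      (fun s _ => (hY _ s).continuousAt.continuousWithinAt)
      (fun s _ => (hY _ s).hasDerivWithinAt)
      (fun s _ => (hY _ s).continuousAt.continuousWithinAt)
      (fun s _ => (hY _ s).hasDerivWithinAt) (by simp [hY0, Prod.dist_eq]) P (right_mem_Icc.2 hP.le)
    rw [sub_zero] at this
    exact (le_max_right _ _).trans this
  obtain ⟨x, hx⟩ : ∃ x : ℝ, (Y (0, x) P).2 + x = 0 := by
    refine mem_range_of_exists_le_of_exists_ge hcont ⟨-R, ?_⟩ ⟨R, ?_⟩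
    · have := sub_mul_le_of_abs_deriv_lt (u := fun s => -(Y (0, -R) s).2) hC hP.le
        (fun t => (hu (-R) t).neg) (fun t h => by
          rw [abs_neg] at h ⊢; exact hbd _ _ h) (by simp [hY0, hR])
      simp only [hY0] at this
      linarith
    · have := sub_mul_le_of_abs_deriv_lt (u := fun s => (Y (0, R) s).2) hC hP.le
        (hu R) (fun t h => hbd _ _ h) (by simp [hY0, hR])
      simp only [hY0] at this
      linarith
  have hanti : ∀ θ, (Y (0, x) (θ + P)).2 = -(Y (0, x) θ).2 := by
    have h1 : ∀ t, HasDerivAt (fun t => Y (0, x) (t + P)) (1, G (Y (0, x) (t + P))) t :=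
      fun t => (hY (0, x) (t + P)).comp_add_const t P
    have h2 : ∀ t, HasDerivAt (fun t => ((t + P, -(Y (0, x) t).2) : ℝ × ℝ))
        (1, G (t + P, -(Y (0, x) t).2)) t := by
      intro t
      refine ((hasDerivAt_id t).add_const P).prodMk ((hu x t).neg.congr_deriv ?_)
      rw [hG_eq, hAP, hBP]
      ring
    have := solution_unique hK h1 h2 (t₀ := 0) (by
      rw [hpt]
      simp only [hY0, Prod.mk.injEq, zero_add, true_and]
      linarith)
    intro θ
    exact congrArg Prod.snd (congrFun this θ)
  have hxR : |x| ≤ R := by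
    by_contra! h
    rcases lt_abs.1 h with h | h
    · have := sub_mul_le_of_abs_deriv_lt (u := fun s => (Y (0, x) s).2) hC hP.le
        (hu x) (fun t h => hbd _ _ h) (by simp only [hY0]; linarith)
      simp only [hY0] at this
      linarith
    · have := sub_mul_le_of_abs_deriv_lt (u := fun s => -(Y (0, x) s).2) hC hP.le
        (fun t => (hu x t).neg) (fun t h => by
          rw [abs_neg] at h ⊢; exact hbd _ _ h) (by simp only [hY0]; linarith)
      simp only [hY0] at this
      linarith
  refine ⟨fun s => (Y (0, x) s).2, hu x, hanti, fun θ => ?_⟩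
  have hper : Function.Periodic (fun s => |(Y (0, x) s).2|) P := fun s => by
    simp only [hanti, abs_neg]
  obtain ⟨s, hs, hsθ⟩ := hper.exists_mem_Ico₀ hP θ
  rw [show |(Y (0, x) θ).2| = _ from hsθ]
  refine (abs_le_add_mul_of_abs_deriv_lt hC (hu x) (fun t h => hbd _ _ h) hR1 (by simpa [hY0])
    (Ico_subset_Icc_self hs)).trans ?_
  have := mul_le_mul_of_nonneg_left hs.2.le hC
  linarith

end Regularized

section CubicLimit

theorem abs_sub_pow_three_le (a b : ℝ) : |a - b| ^ 3 ≤ 4 * |a ^ 3 - b ^ 3| := by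
  have h : a ^ 3 - b ^ 3 = (a - b) * (a ^ 2 + a * b + b ^ 2) := by ring
  have hq : (a - b) ^ 2 ≤ 4 * (a ^ 2 + a * b + b ^ 2) := by nlinarith [sq_nonneg (a + b)]
  have hq0 : 0 ≤ a ^ 2 + a * b + b ^ 2 := by nlinarith [sq_nonneg (a - b)]
  rw [h, abs_mul, abs_of_nonneg hq0]
  calc |a - b| ^ 3 = |a - b| * (a - b) ^ 2 := by rw [← sq_abs (a - b)]; ring
    _ ≤ |a - b| * (4 * (a ^ 2 + a * b + b ^ 2)) := by gcongr
    _ = _ := by ring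

theorem tendsto_zero_of_abs_pow_three_le {ι : Type*} {l : Filter ι} {f g : ι → ℝ}
    (h : ∀ x, |f x| ^ 3 ≤ g x) (hg : Tendsto g l (𝓝 0)) : Tendsto f l (𝓝 0) := by
  rw [Metric.tendsto_nhds]
  intro η hη
  filter_upwards [hg.eventually_lt_const (show (0 : ℝ) < η ^ 3 by positivity)] with x hx
  rw [Real.dist_eq, sub_zero]
  exact lt_of_pow_lt_pow_left₀ 3 hη.le ((h x).trans_lt hx)

/-- For odd data, the singular equation `u² u' = -(A + B u²)`, read as an equation for `u³ / 3`,
has an antiperiodic solution. -/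
theorem exists_antiperiodic_singular {A B : ℝ → ℝ} (hA : BddLip A) (hB : BddLip B) {P : ℝ}
    (hP : 0 < P) (hAP : ∀ θ, A (θ + P) = -A θ) (hBP : ∀ θ, B (θ + P) = -B θ) :
    ∃ v : ℝ → ℝ, Continuous v ∧
      (∀ θ, HasDerivAt (fun s => v s ^ 3 / 3) (-(A θ + B θ * v θ ^ 2)) θ) ∧
      (∀ θ, v (θ + P) = -v θ) ∧ ∃ M, ∀ θ, |v θ| ≤ M := by
  obtain ⟨M, hM⟩ := exists_antiperiodic_regularized hA hB hP hAP hBP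
  set ε : ℕ → ℝ := fun n => 1 / ((n : ℝ) + 1)
  have hε : ∀ n, 0 < ε n := fun n => by positivity
  choose u hu huP huM using fun n => hM (ε n) (hε n)
  obtain ⟨CA, hCA⟩ := hA.1
  obtain ⟨CB, hCB⟩ := hB.1
  have hCA0 := (abs_nonneg _).trans (hCA 0)
  have hCB0 := (abs_nonneg _).trans (hCB 0)
  have hM0 : 0 ≤ M := (abs_nonneg _).trans (huM 0 0)
  set U : Ultrafilter ℕ := Filter.hyperfilter ℕ
  have hUε : Tendsto ε U (𝓝 0) :=
    tendsto_one_div_add_atTop_nhds_zero_nat.mono_left Nat.hyperfilter_le_atTop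
  have hlim : ∀ θ, ∃ x ∈ Icc (-M) M, Tendsto (fun n => u n θ) U (𝓝 x) := fun θ =>
    isCompact_Icc.ultrafilter_le_nhds' (U.map fun n => u n θ)
      (Ultrafilter.mem_map.2 (Filter.univ_mem' fun n => abs_le.1 (huM n θ)))
  choose v hvM hv using hlim
  have hw : ∀ n θ, HasDerivAt (fun s => u n s ^ 3 / 3 + ε n * u n s)
      (-(A θ + B θ * u n θ ^ 2)) θ := by
    intro n θ
    refine ((((hu n θ).pow 3).div_const 3).add ((hu n θ).const_mul (ε n))).congr_deriv ?_
    have : u n θ ^ 2 + ε n ≠ 0 := (add_pos_of_nonneg_of_pos (sq_nonneg _) (hε n)).ne'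
    field_simp
    ring
  set L := CA + CB * M ^ 2
  have hwL : ∀ n θ, |-(A θ + B θ * u n θ ^ 2)| ≤ L := by
    intro n θ
    rw [abs_neg]
    refine (abs_add_le _ _).trans ?_
    rw [abs_mul, abs_of_nonneg (sq_nonneg (u n θ)), ← sq_abs (u n θ)]
    refine add_le_add (hCA θ) ?_
    gcongr
    · exact hCB θ
    · exact huM n θ
  have hhol : ∀ n s t, |u n s - u n t| ^ 3 ≤ 12 * (L * |s - t| + 2 * M * ε n) := by
    intro n s t
    have h1 := convex_univ.norm_image_sub_le_of_norm_hasDerivWithin_le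
      (fun θ _ => (hw n θ).hasDerivWithinAt) (fun θ _ => hwL n θ) (mem_univ t) (mem_univ s)
    rw [Real.norm_eq_abs, Real.norm_eq_abs] at h1
    have h2 := abs_sub_pow_three_le (u n s) (u n t)
    have h3 : |u n s ^ 3 - u n t ^ 3| ≤ 3 * (L * |s - t|) + 3 * (ε n * (|u n s| + |u n t|)) := by
      calc |u n s ^ 3 - u n t ^ 3|
          = |3 * ((u n s ^ 3 / 3 + ε n * u n s) - (u n t ^ 3 / 3 + ε n * u n t))
              + -(3 * (ε n * (u n s - u n t)))| := by ring_nf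
        _ ≤ _ := by
          refine (abs_add_le _ _).trans ?_
          rw [abs_neg, abs_mul, abs_mul 3, abs_mul (ε n), abs_of_pos (hε n),
            abs_of_pos (three_pos : (0 : ℝ) < 3)]
          gcongr
          exact abs_sub _ _
    have h4 : ε n * (|u n s| + |u n t|) ≤ ε n * (M + M) :=
      mul_le_mul_of_nonneg_left (add_le_add (huM n s) (huM n t)) (hε n).le
    linarith
  have hvhol : ∀ s t, |v s - v t| ^ 3 ≤ 12 * (L * |s - t|) := by
    intro s t
    refine le_of_tendsto_of_tendsto' (((hv s).sub (hv t)).abs.pow 3) ?_ fun n => hhol n s t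
    simpa using ((hUε.const_mul (2 * M)).const_add (L * |s - t|)).const_mul 12
  have habs : ∀ θ : ℝ, Tendsto (fun r => 12 * (L * |r - θ|)) (𝓝 θ) (𝓝 0) := fun θ => by
    have : Continuous fun r => 12 * (L * |r - θ|) := by fun_prop
    simpa using this.tendsto θ
  have hv0 : ∀ θ, Tendsto (fun r => v r - v θ) (𝓝 θ) (𝓝 0) := fun θ =>
    tendsto_zero_of_abs_pow_three_le (fun r => hvhol r θ) (habs θ)
  have hvc : Continuous v := continuous_iff_continuousAt.2 fun θ => by
    simpa [ContinuousAt] using (hv0 θ).add_const (v θ)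
  refine ⟨v, hvc, fun θ => ?_, fun θ => ?_, M, fun θ => abs_le.2 (hvM θ)⟩
  · have hunif : Tendsto (fun p : ℕ × ℝ => u p.1 p.2 - v p.2) (U ×ˢ 𝓝 θ) (𝓝 0) := by
      have e1 : Tendsto (fun p : ℕ × ℝ => u p.1 p.2 - u p.1 θ) (U ×ˢ 𝓝 θ) (𝓝 0) := by
        refine tendsto_zero_of_abs_pow_three_le (fun p => hhol p.1 p.2 θ) ?_
        have h1 := (habs θ).comp (tendsto_snd (f := (U : Filter ℕ)))
        have h2 := (hUε.comp (tendsto_fst (g := 𝓝 θ))).const_mul (24 * M)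
        have := h1.add h2
        rw [mul_zero, add_zero] at this
        refine this.congr fun p => ?_
        simp only [Function.comp]
        ring
      have e2 : Tendsto (fun p : ℕ × ℝ => u p.1 θ - v θ) (U ×ˢ 𝓝 θ) (𝓝 0) := by
        simpa using ((hv θ).comp tendsto_fst).sub_const (v θ)
      have e3 : Tendsto (fun p : ℕ × ℝ => v p.2 - v θ) (U ×ˢ 𝓝 θ) (𝓝 0) :=
        (hv0 θ).comp tendsto_snd
      simpa using (e1.add e2).sub e3
    refine hasDerivAt_of_tendstoUniformlyOnFilter (l := (U : Filter ℕ))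
      (f := fun n s => u n s ^ 3 / 3 + ε n * u n s)
      (f' := fun n s => -(A s + B s * u n s ^ 2)) (g' := fun s => -(A s + B s * v s ^ 2))
      ?_ (Eventually.of_forall fun p => hw p.1 p.2) (Eventually.of_forall fun s => ?_)
    · rw [Metric.tendstoUniformlyOnFilter_iff]
      intro η hη
      have hlt := (hunif.abs.const_mul (CB * (M + M))).eventually_lt_const
        (show CB * (M + M) * |(0 : ℝ)| < η by simpa using hη)
      filter_upwards [hlt] with p hp
      refine lt_of_le_of_lt ?_ hp
      rw [Real.dist_eq]
      calc |-(A p.2 + B p.2 * v p.2 ^ 2) - -(A p.2 + B p.2 * u p.1 p.2 ^ 2)|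
          = |B p.2| * |u p.1 p.2 + v p.2| * |u p.1 p.2 - v p.2| := by
            rw [← abs_mul, ← abs_mul]; ring_nf
        _ ≤ CB * (M + M) * |u p.1 p.2 - v p.2| := by
            gcongr
            · exact hCB _
            · exact (abs_add_le _ _).trans (add_le_add (huM _ _) (abs_le.2 (hvM _)))
    · simpa using (((hv s).pow 3).div_const 3).add (hUε.mul (hv s))
  · refine tendsto_nhds_unique (hv (θ + P)) ((hv θ).neg.congr fun n => ?_)
    rw [huP]

end CubicLimit

section Cylinder

/-- Solutions of the equation `u² du/dθ = -(A + B u²)`, desingularized as a complete flow on the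
`(θ, u)`-plane. -/
def IsCylinderSolution (A B θ u : ℝ → ℝ) : Prop :=
  (∀ t, HasDerivAt θ (u t ^ 2 * (u t ^ 2 + 1)⁻¹) t) ∧
    ∀ t, HasDerivAt u (-(A (θ t) + B (θ t) * u t ^ 2) * (u t ^ 2 + 1)⁻¹) t

variable {A B : ℝ → ℝ}

theorem bddLip_cylinder_fst : BddLip (fun y : ℝ × ℝ => y.2 ^ 2 * (y.2 ^ 2 + 1)⁻¹) := by
  convert (BddLip.const 1).add (bddLip_inv_sq_add one_pos).snd.neg using 2 with y
  have : y.2 ^ 2 + 1 ≠ 0 := by positivity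
  field_simp
  ring

theorem bddLip_cylinder_snd (hA : BddLip A) (hB : BddLip B) :
    BddLip (fun y : ℝ × ℝ => -(A y.1 + B y.1 * y.2 ^ 2) * (y.2 ^ 2 + 1)⁻¹) := by
  convert ((hA.fst.mul (bddLip_inv_sq_add one_pos).snd).add
    (hB.fst.mul bddLip_cylinder_fst)).neg using 2 with y
  ring

theorem exists_isCylinderSolution (hA : BddLip A) (hB : BddLip B) (θ₀ u₀ : ℝ) :
    ∃ θ u, IsCylinderSolution A B θ u ∧ θ 0 = θ₀ ∧ u 0 = u₀ := by
  obtain ⟨y, hy0, hy⟩ :=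
    (BddLip.planar_flow bddLip_cylinder_fst (bddLip_cylinder_snd hA hB)).2 (θ₀, u₀)
  exact ⟨fun t => (y t).1, fun t => (y t).2,
    ⟨fun t => (hy t).fst_of_prod, fun t => (hy t).snd_of_prod⟩, by simp [hy0], by simp [hy0]⟩

namespace IsCylinderSolution

variable {θ u θ' u' : ℝ → ℝ}

theorem unique (hA : BddLip A) (hB : BddLip B) (h : IsCylinderSolution A B θ u)
    (h' : IsCylinderSolution A B θ' u') {t₀ : ℝ} (hθ : θ t₀ = θ' t₀) (hu : u t₀ = u' t₀) :
    θ = θ' ∧ u = u' := by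
  obtain ⟨K, hK⟩ := (BddLip.planar_flow bddLip_cylinder_fst (bddLip_cylinder_snd hA hB)).1
  have := solution_unique hK (fun t => (h.1 t).prodMk (h.2 t))
    (fun t => (h'.1 t).prodMk (h'.2 t)) (t₀ := t₀) (by simp [hθ, hu])
  exact ⟨funext fun t => congrArg Prod.fst (congrFun this t),
    funext fun t => congrArg Prod.snd (congrFun this t)⟩

theorem monotone (h : IsCylinderSolution A B θ u) : Monotone θ :=
  monotone_of_hasDerivAt_nonneg h.1 fun t => by positivity

theorem continuous_fst (h : IsCylinderSolution A B θ u) : Continuous θ :=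
  continuous_iff_continuousAt.2 fun t => (h.1 t).continuousAt

theorem continuous_snd (h : IsCylinderSolution A B θ u) : Continuous u :=
  continuous_iff_continuousAt.2 fun t => (h.2 t).continuousAt

/-- A solution through an equilibrium is constant. -/
theorem eq_of_equilibrium (hA : BddLip A) (hB : BddLip B) (h : IsCylinderSolution A B θ u)
    {t₀ : ℝ} (hu : u t₀ = 0) (hA0 : A (θ t₀) = 0) (t : ℝ) : θ t = θ t₀ := by
  have hc : IsCylinderSolution A B (fun _ => θ t₀) (fun _ => 0) :=
    ⟨fun t => by simpa using hasDerivAt_const t (θ t₀),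
      fun t => by simpa [hA0] using hasDerivAt_const t (0 : ℝ)⟩
  exact congrFun (h.unique hA hB hc rfl hu).1 t

/-- Graphs of solutions of the singular equation are invariant under the flow. -/
theorem snd_eq_of_graph (hB : BddLip B) (h : IsCylinderSolution A B θ u) {v : ℝ → ℝ} {M : ℝ}
    (hv : ∀ θ, HasDerivAt (fun s => v s ^ 3 / 3) (-(A θ + B θ * v θ ^ 2)) θ)
    (hM : ∀ θ, |v θ| ≤ M) {t₀ : ℝ} (h0 : u t₀ = v (θ t₀)) (t : ℝ) : u t = v (θ t) := by
  obtain ⟨C, hC⟩ := hB.1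
  have hC0 := (abs_nonneg _).trans (hC 0)
  have hM0 := (abs_nonneg _).trans (hM 0)
  set D : ℝ → ℝ := fun t => u t ^ 3 / 3 - v (θ t) ^ 3 / 3 with hDdef
  set D' : ℝ → ℝ := fun t =>
    -(B (θ t) * (u t ^ 2 * (u t ^ 2 - v (θ t) ^ 2) * (u t ^ 2 + 1)⁻¹)) with hD'def
  have hD : ∀ t, HasDerivAt D (D' t) t := fun t => by
    refine ((((h.2 t).pow 3).div_const 3).sub ((hv (θ t)).comp t (h.1 t))).congr_deriv ?_
    simp only [hD'def]
    ring
  have hbound : ∀ t, |D' t| ≤ C * (4 * (1 + M)) * |D t| := by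
    intro t
    have hM' := hM (θ t)
    have hC' := hC (θ t)
    simp only [hDdef, hD'def]
    generalize u t = a at *
    generalize v (θ t) = b at *
    rw [abs_neg, abs_mul, mul_assoc C]
    have hpos : 0 < a ^ 2 + 1 := by positivity
    refine mul_le_mul hC' ?_ (abs_nonneg _) hC0
    rw [abs_mul, abs_of_pos (inv_pos.2 hpos), ← div_eq_mul_inv, div_le_iff₀ hpos]
    have e1 : a ^ 3 / 3 - b ^ 3 / 3 = (a - b) * ((a ^ 2 + a * b + b ^ 2) / 3) := by ring
    have hq : a ^ 2 ≤ 4 * ((a ^ 2 + a * b + b ^ 2) / 3) := by nlinarith [sq_nonneg (a + 2 * b)]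
    have hq0 : 0 ≤ (a ^ 2 + a * b + b ^ 2) / 3 := by nlinarith [sq_nonneg a]
    have hab : |a + b| ≤ (1 + M) * (a ^ 2 + 1) := by
      have h1 := abs_add_le a b
      have h2 : |a| ≤ a ^ 2 + 1 := by nlinarith [sq_nonneg (|a| - 1), sq_abs a, sq_nonneg a]
      have h3 : 0 ≤ M * a ^ 2 := by positivity
      linarith
    rw [e1, abs_mul (a - b), abs_of_nonneg hq0, abs_mul, abs_of_nonneg (sq_nonneg a),
      show a ^ 2 - b ^ 2 = (a - b) * (a + b) by ring, abs_mul]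
    calc a ^ 2 * (|a - b| * |a + b|)
        ≤ (4 * ((a ^ 2 + a * b + b ^ 2) / 3)) * (|a - b| * ((1 + M) * (a ^ 2 + 1))) := by
          gcongr
      _ = _ := by ring
  have hDz : D = fun _ => 0 := by
    refine ODE_solution_unique_univ (v := fun t x => D' t / D t * x) (s := fun _ => univ)
      (K := (C * (4 * (1 + M))).toNNReal) (t₀ := t₀) (fun t => ?_)
      (fun t => ⟨(hD t).congr_deriv ?_, mem_univ _⟩)
      (fun t => ⟨by simpa using hasDerivAt_const t (0 : ℝ), mem_univ _⟩) (by simp [hDdef, h0])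
    · refine (LipschitzWith.of_dist_le_mul fun x y => ?_).lipschitzOnWith
      rw [Real.coe_toNNReal _ (by positivity), Real.dist_eq, Real.dist_eq, ← mul_sub, abs_mul]
      gcongr
      rw [abs_div]
      exact div_le_of_le_mul₀ (abs_nonneg _) (by positivity) (hbound t)
    · by_cases hDt : D t = 0
      · have := hbound t
        rw [hDt, abs_zero, mul_zero] at this
        rw [abs_nonpos_iff.1 this, hDt, mul_zero]
      · rw [div_mul_cancel₀ _ hDt]
  have hDt : u t ^ 3 / 3 - v (θ t) ^ 3 / 3 = 0 := congrFun hDz t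
  refine (Odd.strictMono_pow (by decide : Odd 3)).injective ?_
  linarith

end IsCylinderSolution

theorem eq_zero_of_tendsto_deriv_atTop {f f' : ℝ → ℝ} {a b : ℝ}
    (hf : ∀ t, HasDerivAt f (f' t) t) (ha : Tendsto f atTop (𝓝 a))
    (hb : Tendsto f' atTop (𝓝 b)) : b = 0 := by
  have hξ : ∀ t : ℝ, ∃ ξ ∈ Ioo t (t + 1), f' ξ = f (t + 1) - f t := by
    intro t
    obtain ⟨ξ, hξ, h⟩ := exists_hasDerivAt_eq_slope f f' (lt_add_one t)
      (fun s _ => (hf s).continuousAt.continuousWithinAt) (fun s _ => hf s)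
    exact ⟨ξ, hξ, by rw [h]; simp⟩
  choose ξ hξ h using hξ
  have h1 : Tendsto ξ atTop atTop := tendsto_atTop_mono (fun t => (hξ t).1.le) tendsto_id
  have h2 : Tendsto (fun t => f (t + 1) - f t) atTop (𝓝 (a - a)) :=
    (ha.comp (tendsto_atTop_add_const_right _ _ tendsto_id)).sub ha
  rw [sub_self] at h2
  exact tendsto_nhds_unique ((hb.comp h1).congr h) h2

theorem eq_zero_of_tendsto_deriv_atBot {f f' : ℝ → ℝ} {a b : ℝ}
    (hf : ∀ t, HasDerivAt f (f' t) t) (ha : Tendsto f atBot (𝓝 a))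
    (hb : Tendsto f' atBot (𝓝 b)) : b = 0 := by
  refine neg_eq_zero.1 (eq_zero_of_tendsto_deriv_atTop (f := fun t => f (-t))
    (f' := fun t => -f' (-t)) (fun t => ?_) (ha.comp tendsto_neg_atTop_atBot)
    (hb.comp tendsto_neg_atTop_atBot).neg)
  exact ((hf (-t)).comp t (hasDerivAt_neg t)).congr_deriv (by simp)

theorem IsCylinderSolution.limit_equilibrium {θ u v : ℝ → ℝ} (hA : Continuous A)
    (hB : Continuous B) (h : IsCylinderSolution A B θ u) (hv : Continuous v)
    (huv : ∀ t, u t = v (θ t)) {l : Filter ℝ}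
    (hl : ∀ (f f' : ℝ → ℝ) (a b : ℝ), (∀ t, HasDerivAt f (f' t) t) → Tendsto f l (𝓝 a) →
      Tendsto f' l (𝓝 b) → b = 0) {θ₁ : ℝ} (hθ : Tendsto θ l (𝓝 θ₁)) :
    v θ₁ = 0 ∧ A θ₁ = 0 := by
  have hu : Tendsto u l (𝓝 (v θ₁)) := ((hv.tendsto θ₁).comp hθ).congr fun t => (huv t).symm
  have hpos : ∀ a : ℝ, a ^ 2 + 1 ≠ 0 := fun a => by positivity
  have hq : Tendsto (fun t => (u t ^ 2 + 1)⁻¹) l (𝓝 (v θ₁ ^ 2 + 1)⁻¹) :=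
    ((hu.pow 2).add_const 1).inv₀ (hpos _)
  have h1 := hl _ _ _ _ h.1 hθ ((hu.pow 2).mul hq)
  have h2 := hl _ _ _ _ h.2 hu (((((hA.tendsto θ₁).comp hθ).add
    (((hB.tendsto θ₁).comp hθ).mul (hu.pow 2))).neg).mul hq)
  have hv0 : v θ₁ = 0 := by simpa [hpos] using h1
  refine ⟨hv0, ?_⟩
  simpa [hv0] using h2

/-- On the cylinder there is either an orbit connecting two equilibria on `u = 0`, or an orbit that
is mapped to itself by the half-turn `(θ, u) ↦ (θ + P, -u)` and crosses `u = 0` transversally. -/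
theorem exists_connection_or_antiperiodic {A B : ℝ → ℝ} (hA : BddLip A) (hB : BddLip B) {P : ℝ}
    (hP : 0 < P) (hAP : ∀ θ, A (θ + P) = -A θ) (hBP : ∀ θ, B (θ + P) = -B θ) {θ₀ : ℝ}
    (hθ₀ : A θ₀ ≠ 0) :
    (∃ θ u : ℝ → ℝ, IsCylinderSolution A B θ u ∧ A (θ 0) ≠ 0 ∧
      (∃ θ₁, A θ₁ = 0 ∧ Tendsto θ atTop (𝓝 θ₁) ∧ Tendsto u atTop (𝓝 0)) ∧
      ∃ θ₁, A θ₁ = 0 ∧ Tendsto θ atBot (𝓝 θ₁) ∧ Tendsto u atBot (𝓝 0)) ∨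
    ∃ T > 0, ∃ θ u : ℝ → ℝ, IsCylinderSolution A B θ u ∧
      (∀ t, θ (t + T) = θ t + P ∧ u (t + T) = -u t) ∧ ∃ t, u t = 0 ∧ A (θ t) ≠ 0 := by
  obtain ⟨v, hvc, hv, hvP, M, hvM⟩ := exists_antiperiodic_singular hA hB hP hAP hBP
  have hAc : Continuous A := hA.2.choose_spec.continuous
  have hBc : Continuous B := hB.2.choose_spec.continuous
  by_cases hZ : ∃ h, v h = 0 ∧ A h = 0
  · left
    obtain ⟨h, hh⟩ := hZ
    have hper : Function.Periodic (fun θ => v θ = 0 ∧ A θ = 0) P := fun θ => by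
      simp [hvP, hAP]
    obtain ⟨h₁, hh₁, e₁⟩ := hper.exists_mem_Ico hP h θ₀
    obtain ⟨h₂, hh₂, e₂⟩ := hper.exists_mem_Ico hP h (θ₀ - P)
    have hz₁ : v h₁ = 0 ∧ A h₁ = 0 := e₁ ▸ hh
    have hz₂ : v h₂ = 0 ∧ A h₂ = 0 := e₂ ▸ hh
    obtain ⟨θ, u, hc, hθ0, hu0⟩ := exists_isCylinderSolution hA hB θ₀ (v θ₀)
    have hgraph := hc.snd_eq_of_graph hB hv hvM (t₀ := 0) (by rw [hθ0, hu0])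
    have hno : ∀ t, ¬ (v (θ t) = 0 ∧ A (θ t) = 0) := fun t ht => hθ₀ <| by
      rw [← hθ0, hc.eq_of_equilibrium hA hB ((hgraph t).trans ht.1) ht.2 0, ht.2]
    have hup : BddAbove (range θ) := by
      refine ⟨h₁, ?_⟩
      rintro _ ⟨t, rfl⟩
      by_contra! hlt
      obtain ⟨s, hs⟩ := mem_range_of_exists_le_of_exists_ge hc.continuous_fst
        ⟨0, by rw [hθ0]; exact hh₁.1⟩ ⟨t, hlt.le⟩
      exact hno s (hs ▸ hz₁)
    have hdown : BddBelow (range θ) := by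
      refine ⟨h₂, ?_⟩
      rintro _ ⟨t, rfl⟩
      by_contra! hlt
      obtain ⟨s, hs⟩ := mem_range_of_exists_le_of_exists_ge hc.continuous_fst
        ⟨t, hlt.le⟩ ⟨0, by rw [hθ0]; linarith [hh₂.2]⟩
      exact hno s (hs ▸ hz₂)
    have htop := tendsto_atTop_ciSup hc.monotone hup
    have hbot := tendsto_atBot_ciInf hc.monotone hdown
    have hp := hc.limit_equilibrium hAc hBc hvc hgraph
      (fun _ _ _ _ => eq_zero_of_tendsto_deriv_atTop) htop
    have hq := hc.limit_equilibrium hAc hBc hvc hgraph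
      (fun _ _ _ _ => eq_zero_of_tendsto_deriv_atBot) hbot
    have hlim : ∀ {l : Filter ℝ} {θ₁ : ℝ}, Tendsto θ l (𝓝 θ₁) → v θ₁ = 0 →
        Tendsto u l (𝓝 0) := fun {l θ₁} hl h0 => by
      rw [← h0]
      exact ((hvc.tendsto θ₁).comp hl).congr fun t => (hgraph t).symm
    exact ⟨θ, u, hc, by rwa [hθ0], ⟨_, hp.2, htop, hlim htop hp.1⟩,
      ⟨_, hq.2, hbot, hlim hbot hq.1⟩⟩
  · right
    push Not at hZ
    obtain ⟨θ, u, hc, hθ0, hu0⟩ := exists_isCylinderSolution hA hB 0 (v 0)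
    have hgraph := hc.snd_eq_of_graph hB hv hvM (t₀ := 0) (by rw [hθ0, hu0])
    have hunb : ∃ t, P ≤ θ t := by
      by_contra! hlt
      have hup : BddAbove (range θ) := ⟨P, by rintro _ ⟨t, rfl⟩; exact (hlt t).le⟩
      have hp := hc.limit_equilibrium hAc hBc hvc hgraph
        (fun _ _ _ _ => eq_zero_of_tendsto_deriv_atTop) (tendsto_atTop_ciSup hc.monotone hup)
      exact hZ _ hp.1 hp.2
    obtain ⟨T, hT⟩ : ∃ T, θ T = P := mem_range_of_exists_le_of_exists_ge hc.continuous_fst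
      ⟨0, by rw [hθ0]; exact hP.le⟩ hunb
    have hT0 : 0 < T := by
      by_contra! hle
      have := hc.monotone hle
      rw [hT, hθ0] at this
      exact absurd this (not_le.2 hP)
    have huT : u T = -u 0 := by
      rw [hgraph, hgraph 0, hT, hθ0, ← hvP, zero_add]
    have hc₁ : IsCylinderSolution A B (fun t => θ (t + T)) (fun t => u (t + T)) :=
      ⟨fun t => (hc.1 (t + T)).comp_add_const t T, fun t => (hc.2 (t + T)).comp_add_const t T⟩
    have hc₂ : IsCylinderSolution A B (fun t => θ t + P) (fun t => -u t) := by
      refine ⟨fun t => ((hc.1 t).add_const P).congr_deriv (by ring), fun t =>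
        (hc.2 t).neg.congr_deriv ?_⟩
      rw [hAP, hBP]
      ring
    obtain ⟨hθT, huT'⟩ := hc₁.unique hA hB hc₂ (t₀ := 0) (by simp [hT, hθ0]) (by simp [huT])
    refine ⟨T, hT0, θ, u, hc, fun t => ⟨congrFun hθT t, congrFun huT' t⟩, ?_⟩
    obtain ⟨t₀, ht₀⟩ : ∃ t, u t = 0 := by
      rcases le_total (u 0) 0 with h | h
      · exact mem_range_of_exists_le_of_exists_ge hc.continuous_snd ⟨0, h⟩
          ⟨T, by rw [huT]; linarith⟩
      · exact mem_range_of_exists_le_of_exists_ge hc.continuous_snd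
          ⟨T, by rw [huT]; linarith⟩ ⟨0, h⟩
    exact ⟨t₀, ht₀, hZ _ ((hgraph t₀).symm.trans ht₀)⟩

end Cylinder

section Sphere

/-- The trigonometric form of the cubic part of the system. -/
noncomputable def cubicTrig (a1 a2 a3 θ : ℝ) : ℝ :=
  Real.cos θ * (a1 * (Real.cos θ * Real.cos θ) + a2 * (Real.cos θ * Real.sin θ)
    + a3 * (Real.sin θ * Real.sin θ))

/-- The trigonometric form of the linear part of the system. -/
noncomputable def linearTrig (b1 b2 θ : ℝ) : ℝ :=
  b1 * Real.cos θ + b2 * Real.sin θ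

theorem bddLip_cubicTrig (a1 a2 a3 : ℝ) : BddLip (cubicTrig a1 a2 a3) :=
  bddLip_cos.mul ((((BddLip.const a1).mul (bddLip_cos.mul bddLip_cos)).add
    ((BddLip.const a2).mul (bddLip_cos.mul bddLip_sin))).add
      ((BddLip.const a3).mul (bddLip_sin.mul bddLip_sin)))

theorem bddLip_linearTrig (b1 b2 : ℝ) : BddLip (linearTrig b1 b2) :=
  ((BddLip.const b1).mul bddLip_cos).add ((BddLip.const b2).mul bddLip_sin)

theorem cubicTrig_add_pi (a1 a2 a3 θ : ℝ) :
    cubicTrig a1 a2 a3 (θ + Real.pi) = -cubicTrig a1 a2 a3 θ := by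
  simp only [cubicTrig, Real.cos_add_pi, Real.sin_add_pi]
  ring

theorem linearTrig_add_pi (b1 b2 θ : ℝ) :
    linearTrig b1 b2 (θ + Real.pi) = -linearTrig b1 b2 θ := by
  simp only [linearTrig, Real.cos_add_pi, Real.sin_add_pi]
  ring

theorem exists_cubicTrig_ne_zero {a1 a2 a3 : ℝ} (ha3 : a3 ≠ 0) :
    ∃ θ, cubicTrig a1 a2 a3 θ ≠ 0 := by
  by_contra! h
  have h0 := h 0
  have h1 := h (Real.pi / 4)
  have h2 := h (-(Real.pi / 4))
  simp only [cubicTrig, Real.cos_zero, Real.sin_zero, Real.cos_neg, Real.sin_neg,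
    Real.cos_pi_div_four, Real.sin_pi_div_four] at h0 h1 h2
  have hs : Real.sqrt 2 * Real.sqrt 2 = 2 := Real.mul_self_sqrt zero_le_two
  have hs0 : Real.sqrt 2 / 2 ≠ 0 := by positivity
  have h1' := (mul_eq_zero.1 h1).resolve_left hs0
  have h2' := (mul_eq_zero.1 h2).resolve_left hs0
  exact ha3 (by linear_combination (h1' + h2') - h0 - (a1 + a3) / 2 * hs)

/-- The point of the unit sphere with longitude `θ` and slope `u` over the equator. -/
noncomputable def spherePoint (θ u : ℝ) : ℝ × ℝ × ℝ :=
  ((Real.sqrt (u ^ 2 + 1))⁻¹ * Real.cos θ, (Real.sqrt (u ^ 2 + 1))⁻¹ * Real.sin θ,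
    (Real.sqrt (u ^ 2 + 1))⁻¹ * u)

theorem sqrt_sq_add_one_pos (u : ℝ) : 0 < Real.sqrt (u ^ 2 + 1) :=
  Real.sqrt_pos.2 (by positivity)

theorem continuous_spherePoint : Continuous fun y : ℝ × ℝ => spherePoint y.1 y.2 := by
  have h : ∀ y : ℝ × ℝ, Real.sqrt (y.2 ^ 2 + 1) ≠ 0 := fun y => (sqrt_sq_add_one_pos _).ne'
  unfold spherePoint
  fun_prop (disch := exact h _)

theorem spherePoint_mem_sphere (θ u : ℝ) :
    (spherePoint θ u).1 ^ 2 + (spherePoint θ u).2.1 ^ 2 + (spherePoint θ u).2.2 ^ 2 = 1 := by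
  have h := sqrt_sq_add_one_pos u
  have h2 : Real.sqrt (u ^ 2 + 1) ^ 2 = u ^ 2 + 1 := Real.sq_sqrt (by positivity)
  simp only [spherePoint]
  field_simp
  rw [h2]
  linarith [Real.sin_sq_add_cos_sq θ]

theorem spherePoint_add_pi_neg (θ u : ℝ) : spherePoint (θ + Real.pi) (-u) = -spherePoint θ u := by
  simp [spherePoint, Real.cos_add_pi, Real.sin_add_pi]

theorem spherePoint_zero (θ : ℝ) : spherePoint θ 0 = (Real.cos θ, Real.sin θ, 0) := by
  simp [spherePoint]

theorem tendsto_spherePoint {l : Filter ℝ} {θ u : ℝ → ℝ} {θ₁ : ℝ} (hθ : Tendsto θ l (𝓝 θ₁))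
    (hu : Tendsto u l (𝓝 0)) :
    Tendsto (fun t => spherePoint (θ t) (u t)) l (𝓝 (Real.cos θ₁, Real.sin θ₁, 0)) := by
  rw [← spherePoint_zero]
  have h : Tendsto (fun t => (θ t, u t)) l (𝓝 (θ₁, 0)) := hθ.prodMk_nhds hu
  have h' := continuous_spherePoint.continuousAt.tendsto.comp h
  simpa only [Function.comp_def] using h'

theorem eq_zero_of_spherePoint_snd_snd {θ u : ℝ} (h : (spherePoint θ u).2.2 = 0) : u = 0 :=
  (mul_eq_zero.1 h).resolve_left (inv_ne_zero (sqrt_sq_add_one_pos u).ne')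

theorem Xfield_equator (b1 b2 a1 a2 a3 θ : ℝ) :
    Xfield b1 b2 a1 a2 a3 (Real.cos θ, Real.sin θ, 0) = (0, 0, -cubicTrig a1 a2 a3 θ) := by
  ext
  · simp [Xfield]
  · simp [Xfield]
  · simp only [Xfield, cubicTrig]
    ring

theorem Xfield_equator_eq_zero {b1 b2 a1 a2 a3 θ : ℝ} :
    Xfield b1 b2 a1 a2 a3 (Real.cos θ, Real.sin θ, 0) = 0 ↔ cubicTrig a1 a2 a3 θ = 0 := by
  simp [Xfield_equator, Prod.ext_iff]

theorem IsCylinderSolution.isSolutionS {b1 b2 a1 a2 a3 : ℝ} {θ u : ℝ → ℝ}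
    (h : IsCylinderSolution (cubicTrig a1 a2 a3) (linearTrig b1 b2) θ u) :
    IsSolutionS b1 b2 a1 a2 a3 fun t => spherePoint (θ t) (u t) := by
  intro t
  have hθ := h.1 t
  have hu := h.2 t
  have hs := sqrt_sq_add_one_pos (u t)
  have hr2 : (u t ^ 2 + 1)⁻¹ = (Real.sqrt (u t ^ 2 + 1))⁻¹ ^ 2 := by
    rw [inv_pow, Real.sq_sqrt (by positivity)]
  rw [hr2] at hθ hu
  have hsqrt := (((hu.pow 2).add_const 1).sqrt (by positivity : u t ^ 2 + 1 ≠ 0)).inv hs.ne'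
  have hr : HasDerivAt (fun t => (Real.sqrt (u t ^ 2 + 1))⁻¹)
      (u t * (cubicTrig a1 a2 a3 (θ t) + linearTrig b1 b2 (θ t) * u t ^ 2)
        * (Real.sqrt (u t ^ 2 + 1))⁻¹ ^ 5) t := by
    refine hsqrt.congr_deriv ?_
    simp only [Nat.cast_ofNat, Pi.pow_apply, Nat.add_one_sub_one, pow_one]
    field_simp
  have h1 := (hr.mul hθ.cos).prodMk ((hr.mul hθ.sin).prodMk (hr.mul hu))
  refine h1.congr_deriv ?_
  simp only [Xfield, spherePoint, cubicTrig, linearTrig]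
  generalize (Real.sqrt (u t ^ 2 + 1))⁻¹ = r
  ext
  · simp only; ring
  · simp only; ring
  · simp only; ring

theorem IsCylinderSolution.exists_spherePoint_ne {b1 b2 a1 a2 a3 : ℝ} {θ u : ℝ → ℝ}
    (h : IsCylinderSolution (cubicTrig a1 a2 a3) (linearTrig b1 b2) θ u)
    (hA : cubicTrig a1 a2 a3 (θ 0) ≠ 0) {l : Filter ℝ} [l.NeBot] (hu : Tendsto u l (𝓝 0))
    {θ₁ : ℝ} (hθ : Tendsto θ l (𝓝 θ₁)) :
    ∃ t s, spherePoint (θ t) (u t) ≠ spherePoint (θ s) (u s) := by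
  by_contra! hconst
  have hd := (hasDerivAt_const (0 : ℝ) (spherePoint (θ 0) (u 0))).congr_of_eventuallyEq
    (f₁ := fun t => spherePoint (θ t) (u t)) (Eventually.of_forall fun t => hconst t 0)
  have hX := (h.isSolutionS (b1 := b1) (b2 := b2) 0).unique hd
  have hp := tendsto_nhds_unique
    (tendsto_const_nhds.congr fun t => hconst 0 t) (tendsto_spherePoint hθ hu)
  have hu0 : u 0 = 0 := eq_zero_of_spherePoint_snd_snd (congrArg (fun z => z.2.2) hp)
  simp only [hu0, spherePoint_zero, Xfield_equator_eq_zero] at hX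
  exact hA hX

end Sphere

theorem periodic_orbit_six_cusps (b1 b2 a1 a2 a3 : ℝ)
    (ha3 : a3 ≠ 0) (hD : a2^2 - 4*a1*a3 > 0)
    (hconn : ¬ ∃ f : ℝ → ℝ × ℝ × ℝ, ∃ p q : ℝ × ℝ × ℝ,
      IsSolutionS b1 b2 a1 a2 a3 f ∧
      (∀ t : ℝ, (f t).1^2 + (f t).2.1^2 + (f t).2.2^2 = 1) ∧
      (∃ t s : ℝ, f t ≠ f s) ∧
      p.1^2 + p.2.1^2 = 1 ∧ p.2.2 = 0 ∧ Xfield b1 b2 a1 a2 a3 p = 0 ∧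
      q.1^2 + q.2.1^2 = 1 ∧ q.2.2 = 0 ∧ Xfield b1 b2 a1 a2 a3 q = 0 ∧
      Filter.Tendsto f Filter.atTop (nhds p) ∧
      Filter.Tendsto f Filter.atBot (nhds q)) :
    ∃ T > (0:ℝ), ∃ f : ℝ → ℝ × ℝ × ℝ,
      IsSolutionS b1 b2 a1 a2 a3 f ∧
      (∀ t : ℝ, (f t).1^2 + (f t).2.1^2 + (f t).2.2^2 = 1) ∧
      (∀ t : ℝ, f (t + T) = -f t) ∧
      (∃ t0 : ℝ, (f t0).2.2 = 0 ∧ Xfield b1 b2 a1 a2 a3 (f t0) ≠ 0) := by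
  obtain ⟨θ₀, hθ₀⟩ := exists_cubicTrig_ne_zero (a1 := a1) (a2 := a2) ha3
  obtain ⟨θ, u, hc, h0, ⟨θ₁, hz₁, hθ₁, hu₁⟩, θ₂, hz₂, hθ₂, hu₂⟩ |
      ⟨T, hT, θ, u, hc, hper, t₀, ht₀, h0⟩ :=
    exists_connection_or_antiperiodic (bddLip_cubicTrig a1 a2 a3) (bddLip_linearTrig b1 b2)
      Real.pi_pos (cubicTrig_add_pi a1 a2 a3) (linearTrig_add_pi b1 b2) hθ₀
  · exact absurd ⟨_, _, _, hc.isSolutionS, fun t => spherePoint_mem_sphere _ _,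
      hc.exists_spherePoint_ne h0 hu₁ hθ₁, Real.cos_sq_add_sin_sq _, rfl,
      Xfield_equator_eq_zero.2 hz₁, Real.cos_sq_add_sin_sq _, rfl, Xfield_equator_eq_zero.2 hz₂,
      tendsto_spherePoint hθ₁ hu₁, tendsto_spherePoint hθ₂ hu₂⟩ hconn
  · refine ⟨T, hT, _, hc.isSolutionS, fun t => spherePoint_mem_sphere _ _, fun t => ?_, t₀, ?_⟩
    · rw [(hper t).1, (hper t).2, spherePoint_add_pi_neg]
    · rw [ht₀, spherePoint_zero]
      exact ⟨rfl, mt Xfield_equator_eq_zero.1 h0⟩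
end

section
/- Assume b2 ≠ 0 and, writing c = a1 + b1*b2^2, assume a2*b2^3 + 2*a1*c = 0 and a3*b2^6 - a1*c^2 = 0. Then the straight line -b2^3*x + c*y + b2^2 = 0 is invariant for the rigid system (E): for every (x,y) in R^2 with -b2^3*x + c*y + b2^2 = 0, one has -b2^3*P(x,y) + c*Q(x,y) = 0, i.e. the vector field of (E) is tangent to the line at each of its points. -/
/-- The function `F` of the rigid system. -/
noncomputable def Ffun (b1 b2 a1 a2 a3 x y : ℝ) : ℝ :=
  b1*x + b2*y + a1*x^3 + a2*x^2*y + a3*x*y^2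

/-- First component of the rigid vector field. -/
noncomputable def Pfun (b1 b2 a1 a2 a3 x y : ℝ) : ℝ :=
  -y + x * Ffun b1 b2 a1 a2 a3 x y

/-- Second component of the rigid vector field. -/
noncomputable def Qfun (b1 b2 a1 a2 a3 x y : ℝ) : ℝ :=
  x + y * Ffun b1 b2 a1 a2 a3 x y

theorem invariant_line (b1 b2 a1 a2 a3 : ℝ) (hb2 : b2 ≠ 0)
    (h1 : a2 * b2^3 + 2*a1*(a1 + b1*b2^2) = 0)
    (h2 : a3 * b2^6 - a1*(a1 + b1*b2^2)^2 = 0) :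
    ∀ x y : ℝ, -b2^3 * x + (a1 + b1*b2^2) * y + b2^2 = 0 →
      -b2^3 * Pfun b1 b2 a1 a2 a3 x y + (a1 + b1*b2^2) * Qfun b1 b2 a1 a2 a3 x y = 0 := by
  intro x y hL
  have key : b2^2 * (a1*x^2 + a2*x*y + a3*y^2) - a1 = 0 := by
    apply mul_left_cancel₀ (pow_ne_zero 4 hb2)
    linear_combination b2^3*x*y*h1 + y^2*h2
      + a1*(-b2^3*x + (a1 + b1*b2^2)*y - b2^2)*hL
  unfold Pfun Qfun
  have hF : Ffun b1 b2 a1 a2 a3 x y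
      = b1*x + b2*y + x*(a1*x^2 + a2*x*y + a3*y^2) := by
    unfold Ffun
    ring
  linear_combination Ffun b1 b2 a1 a2 a3 x y * hL - x*key - b2^2*hF
end
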